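/- Let T be a densely defined linear operator in H, let V_n ⊆ dom(T), n ∈ ℕ, be finite-dimensional subspaces with P_{V_n} →s I, and let Ω ⊆ W_{e1}(T) be a nonempty compact set. Then there exist finite-dimensional subspaces H_n with V_n ⊆ H_n ⊆ dom(T) such that P_{H_n} →s I and sup_{λ∈Ω} dist(λ, σ(T_{H_n})) → 0 as n → ∞, where T_{H_n} := P_{H_n} T|_{H_n}. Moreover, if Ω is a finite subset of the interior of W_{e1}(T), then the H_n can be chosen so that σ(T_{H_n}) = σ(T_{V_n}) ∪ Ω for every n. -/

import Mathlib

open Filter Topology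

noncomputable section

variable {H : Type*} [NormedAddCommGroup H] [InnerProductSpace ℂ H] [CompleteSpace H]

/-- A sequence in an inner product space converges weakly to zero. -/
def WeakNull {E : Type*} [NormedAddCommGroup E] [InnerProductSpace ℂ E] (x : ℕ → E) : Prop :=
  ∀ y : E, Tendsto (fun n => (inner ℂ (x n) y : ℂ)) atTop (nhds 0)

/-- The numerical range of a (possibly unbounded) linear operator `T` in `H`,
`W(T) = {⟨Tx, x⟩ : x ∈ dom T, ‖x‖ = 1}`. -/
def numRange (T : H →ₗ.[ℂ] H) : Set ℂ :=
  {z | ∃ x : T.domain, ‖(x : H)‖ = 1 ∧ (inner ℂ ((x : H)) (T x) : ℂ) = z}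

/-- The essential numerical range of a (possibly unbounded) linear operator `T` in `H`. -/
def essNumRange (T : H →ₗ.[ℂ] H) : Set ℂ :=
  {z | ∃ x : ℕ → T.domain, (∀ n, ‖((x n : H))‖ = 1) ∧
    WeakNull (fun n => ((x n : H))) ∧
    Tendsto (fun n => (inner ℂ ((x n : H)) (T (x n)) : ℂ)) atTop (nhds z)}

/-- The essential spectrum `σ_e(T)` (the version `σ_{e2}` via singular Weyl sequences). -/
def essSpec (T : H →ₗ.[ℂ] H) : Set ℂ :=
  {z | ∃ x : ℕ → T.domain, (∀ n, ‖((x n : H))‖ = 1) ∧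
    WeakNull (fun n => ((x n : H))) ∧
    Tendsto (fun n => ‖T (x n) - z • ((x n : H))‖) atTop (nhds 0)}

/-- `W_{e1}(T)`: intersection over all finite-dimensional subspaces `V ⊆ H` of the
closure of `W(T|_{V^⊥ ∩ dom T})`. -/
def We1 (T : H →ₗ.[ℂ] H) : Set ℂ :=
  ⋂ (V : Submodule ℂ H) (_ : FiniteDimensional ℂ V),
    closure (numRange (T.domRestrict Vᗮ))

/-- The orthogonal projection onto a finite-dimensional subspace. -/
def projFD (M : Submodule ℂ H) (hfd : FiniteDimensional ℂ ↥M) : H →L[ℂ] ↥M :=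
  letI := hfd
  letI : CompleteSpace ↥M := FiniteDimensional.complete ℂ ↥M
  Submodule.orthogonalProjectionOnto M

/-- The compression `T_M = P_M T|_M` of `T` to a finite-dimensional subspace
`M ⊆ dom T`, as an endomorphism of `M`. -/
def compressFD (T : H →ₗ.[ℂ] H) (M : Submodule ℂ H) (hfd : FiniteDimensional ℂ ↥M)
    (h : M ≤ T.domain) : ↥M →ₗ[ℂ] ↥M :=
  (projFD M hfd).toLinearMap ∘ₗ (T.toFun.comp (Submodule.inclusion h))

/-- The set of eigenvalues `σ(T_M)` of the compression of `T` to `M`. -/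
def eigSet (T : H →ₗ.[ℂ] H) (M : Submodule ℂ H) (hfd : FiniteDimensional ℂ ↥M)
    (h : M ≤ T.domain) : Set ℂ :=
  {μ : ℂ | Module.End.HasEigenvalue (compressFD T M hfd h) μ}


lemma exists_phase (α β : ℂ) : ∃ c : ℂ, ‖c‖ = 1 ∧ (star c * α + c * β).im = 0 := by
  by_cases h : β - star α = 0
  · refine ⟨1, by simp, ?_⟩
    have : β = star α := sub_eq_zero.mp h
    simp [this]
  · set γ := β - star α with hγ
    have hn : (‖γ‖ : ℝ) ≠ 0 := norm_ne_zero_iff.mpr h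
    refine ⟨star γ / ‖γ‖, by simp [hn], ?_⟩
    have h1 : β = γ + star α := by rw [hγ]; ring
    have h2 : star (star γ / (‖γ‖ : ℂ)) * α + star γ / ‖γ‖ * β
        = (γ * star γ) / ‖γ‖ + (star (star γ / (‖γ‖ : ℂ)) * α + star (star (star γ / (‖γ‖ : ℂ)) * α)) := by
      rw [h1]; simp; ring
    rw [h2]
    have h3 : γ * star γ = ((‖γ‖ ^ 2 : ℝ) : ℂ) := by
      push_cast
      exact Complex.mul_conj' γ
    rw [h3, Complex.add_im, ← Complex.ofReal_div, Complex.ofReal_im]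
    simp [-star_div₀, -RCLike.star_def]
    ring

lemma numRange_convex (S : H →ₗ.[ℂ] H) : Convex ℝ (numRange S) := by
  rw [convex_iff_segment_subset]
  rintro p ⟨x, hx, hp⟩ q ⟨y, hy, hq⟩
  by_cases hpq : p = q
  · subst hpq
    rw [segment_same]
    rintro _ rfl
    exact ⟨x, hx, hp⟩
  rw [segment_eq_image]
  rintro _ ⟨s, ⟨hs0, hs1⟩, rfl⟩
  have hqp : q - p ≠ 0 := sub_ne_zero.mpr (Ne.symm hpq)
  obtain ⟨c, hc, hk⟩ := exists_phase
    ((inner ℂ (x : H) (S y) - p * inner ℂ (x : H) (y : H)) / (q - p))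
    ((inner ℂ (y : H) (S x) - p * inner ℂ (y : H) (x : H)) / (q - p))
  set α := ((inner ℂ (x : H) (S y) - p * inner ℂ (x : H) (y : H)) / (q - p)) with hα
  set β := ((inner ℂ (y : H) (S x) - p * inner ℂ (y : H) (x : H)) / (q - p)) with hβ
  set k : ℝ := (star c * α + c * β).re with hkdef
  have hkC : star c * α + c * β = (k : ℂ) := Complex.ext rfl (by simpa using hk)
  have hα' : inner ℂ (x : H) (S y) = p * inner ℂ (x : H) (y : H) + α * (q - p) := by
    rw [hα]; field_simp; ring
  have hβ' : inner ℂ (y : H) (S x) = p * inner ℂ (y : H) (x : H) + β * (q - p) := by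
    rw [hβ]; field_simp; ring
  have hcc : star c * c = 1 := by
    have := Complex.conj_mul' c
    rw [hc] at this
    simpa using this
  have hxx : inner ℂ (x : H) (x : H) = (1 : ℂ) := by
    rw [inner_self_eq_norm_sq_to_K, hx]; simp
  have hyy : inner ℂ (y : H) (y : H) = (1 : ℂ) := by
    rw [inner_self_eq_norm_sq_to_K, hy]; simp
  let u : ℝ → S.domain := fun t => ((1 - t : ℝ) * c : ℂ) • x + (t : ℂ) • y
  have hu : ∀ t, ((u t : S.domain) : H) = ((1 - t : ℝ) * c : ℂ) • (x : H) + (t : ℂ) • (y : H) :=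
    fun t => rfl
  have hSu : ∀ t, S (u t) = ((1 - t : ℝ) * c : ℂ) • S x + (t : ℂ) • S y := by
    intro t
    simp only [u, LinearPMap.map_add, LinearPMap.map_smul]
  have hN : ∀ t : ℝ, inner ℂ (u t : H) (S (u t)) - p * inner ℂ (u t : H) (u t : H)
      = (q - p) * ((t ^ 2 + t * (1 - t) * k : ℝ) : ℂ) := by
    intro t
    rw [hSu, hu]
    simp only [inner_add_left, inner_add_right, inner_smul_left, inner_smul_right, hα', hβ',
      hxx, hyy, hp, hq, map_mul, Complex.conj_ofReal]
    push_cast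
    rw [← hkC]
    simp only [RCLike.star_def]
    ring
  have hnorm : ∀ t : ℝ, inner ℂ (u t : H) (u t : H) = ((‖(u t : H)‖ ^ 2 : ℝ) : ℂ) := by
    intro t
    rw [inner_self_eq_norm_sq_to_K]; push_cast; rfl
  have hcont : Continuous (fun t : ℝ => (t ^ 2 + t * (1 - t) * k) - s * ‖(u t : H)‖ ^ 2) := by
    simp only [hu]
    fun_prop
  have h0 : (fun t : ℝ => (t ^ 2 + t * (1 - t) * k) - s * ‖(u t : H)‖ ^ 2) 0 ≤ 0 := by
    simp [hu, norm_smul, hc, hx, hs0]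
  have h1 : 0 ≤ (fun t : ℝ => (t ^ 2 + t * (1 - t) * k) - s * ‖(u t : H)‖ ^ 2) 1 := by
    simp [hu, hy, hs1]
  obtain ⟨t, ⟨ht0, ht1⟩, ht⟩ := intermediate_value_Icc (zero_le_one' ℝ) hcont.continuousOn ⟨h0, h1⟩
  simp only at ht
  have hune : (u t : H) ≠ 0 := by
    intro h
    have hNt := hN t
    have e1 : ((1 - t : ℝ) * c : ℂ) • (x : H) = - ((t : ℂ) • (y : H)) :=
      eq_neg_of_add_eq_zero_left (by rw [← hu]; exact h)
    have e2 := congrArg norm e1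
    rw [norm_neg, norm_smul, norm_smul, hx, hy, norm_mul, hc, Complex.norm_real, Complex.norm_real,
      Real.norm_of_nonneg (by linarith), Real.norm_of_nonneg ht0] at e2
    have e3 : t = 1 / 2 := by linarith
    -- y = - c x
    have e4 : (y : H) = (-c) • (x : H) := by
      rw [e3] at e1
      have := congrArg (fun v : H => (2 : ℂ) • v) e1
      simp only [smul_smul, smul_neg] at this
      norm_num at this
      rw [show (2 * (1 / 2 * c) : ℂ) = c by ring] at this
      rw [neg_smul, this, neg_neg]
    have e5 : y = (-c) • x := Subtype.ext e4
    apply hpq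
    rw [← hp, ← hq, e5, LinearPMap.map_smul]
    simp only [Submodule.coe_smul, inner_smul_left, inner_smul_right, hp, map_neg]
    have : (starRingEnd ℂ) c * c = 1 := hcc
    linear_combination (-p) * this
  have hn0 : ‖(u t : H)‖ ≠ 0 := norm_ne_zero_iff.mpr hune
  refine ⟨((‖(u t : H)‖⁻¹ : ℝ) : ℂ) • u t, ?_, ?_⟩
  · rw [Submodule.coe_smul, norm_smul, Complex.norm_real, norm_inv, norm_norm, inv_mul_cancel₀ hn0]
  · have e1 := hN t
    rw [hnorm, show t ^ 2 + t * (1 - t) * k = s * ‖(u t : H)‖ ^ 2 by linarith] at e1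
    have e2 : inner ℂ (u t : H) (S (u t)) = ((p + s * (q - p)) * (‖(u t : H)‖ : ℂ) ^ 2) := by
      push_cast at e1
      linear_combination e1
    rw [LinearPMap.map_smul, Submodule.coe_smul, inner_smul_left, inner_smul_right, e2,
      Complex.conj_ofReal]
    have hn0' : (‖(u t : H)‖ : ℂ) ≠ 0 := by exact_mod_cast hn0
    simp only [Complex.real_smul]
    push_cast
    field_simp
    ring

lemma convex_interior_closure {s : Set ℂ} (hs : Convex ℝ s) : interior (closure s) ⊆ s := by
  intro z hz
  have hne : (interior (closure s)).Nonempty := ⟨z, hz⟩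
  have h1 : affineSpan ℝ (closure s) = ⊤ :=
    (hs.closure.interior_nonempty_iff_affineSpan_eq_top).1 hne
  have h2 : affineSpan ℝ s = ⊤ := by
    rw [eq_top_iff, ← h1, affineSpan_le]
    exact closure_minimal (subset_affineSpan ℝ s) (AffineSubspace.closed_of_finiteDimensional _)
  have h3 : (interior s).Nonempty := (hs.interior_nonempty_iff_affineSpan_eq_top).2 h2
  rw [hs.interior_closure_eq_interior_of_nonempty_interior h3] at hz
  exact interior_subset hz

lemma inner_projFD (M : Submodule ℂ H) (hfd : FiniteDimensional ℂ ↥M) (z : M) (v : H) :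
    inner ℂ (z : H) ((projFD M hfd v : M) : H) = inner ℂ (z : H) v := by
  have : CompleteSpace ↥M := FiniteDimensional.complete ℂ ↥M
  have := Submodule.inner_orthogonalProjectionOnto_eq_of_mem_left z v
  rw [Submodule.coe_inner] at this
  exact this

lemma mem_eigSet (T : H →ₗ.[ℂ] H) (M : Submodule ℂ H) (hfd : FiniteDimensional ℂ ↥M)
    (h : M ≤ T.domain) (μ : ℂ) : μ ∈ eigSet T M hfd h ↔
    ∃ y : T.domain, (y : H) ∈ M ∧ (y : H) ≠ 0 ∧
      ∀ z ∈ M, inner ℂ z (T y) = μ * inner ℂ z (y : H) := by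
  constructor
  · intro hμ
    obtain ⟨y, hy⟩ := Module.End.HasEigenvalue.exists_hasEigenvector hμ
    refine ⟨Submodule.inclusion h y, y.2, by simpa using hy.2, fun z hz => ?_⟩
    have e := hy.apply_eq_smul
    rw [← inner_projFD M hfd ⟨z, hz⟩]
    change inner ℂ z ((compressFD T M hfd h y : M) : H) = _
    rw [e, Submodule.coe_smul, inner_smul_right]
    rfl
  · rintro ⟨y, hyM, hy0, hy⟩
    refine Module.End.hasEigenvalue_of_hasEigenvector (x := ⟨y, hyM⟩)
      (Module.End.hasEigenvector_iff.2 ⟨Module.End.mem_eigenspace_iff.2 ?_, ?_⟩)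
    · apply ext_inner_left ℂ
      intro z
      rw [Submodule.coe_inner, Submodule.coe_inner]
      change inner ℂ (z : H) ((projFD M hfd (T ⟨y, _⟩) : M) : H) = _
      rw [inner_projFD, Submodule.coe_smul, inner_smul_right]
      exact hy z z.2
    · intro h0
      exact hy0 (congrArg Subtype.val h0)

lemma eigSet_extend (T : H →ₗ.[ℂ] H) (V : Submodule ℂ H) (hfd : FiniteDimensional ℂ ↥V)
    (h : V ≤ T.domain) (x : T.domain) (hx : ‖(x : H)‖ = 1)
    (hxV : ∀ v ∈ V, inner ℂ v (x : H) = 0)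
    (hxTV : ∀ v : T.domain, (v : H) ∈ V → inner ℂ (x : H) (T v) = 0)
    (hfd' : FiniteDimensional ℂ ↥(V ⊔ ℂ ∙ (x : H))) (h' : V ⊔ ℂ ∙ (x : H) ≤ T.domain) :
    eigSet T (V ⊔ ℂ ∙ (x : H)) hfd' h' = eigSet T V hfd h ∪ {inner ℂ (x : H) (T x)} := by
  have hxx : inner ℂ (x : H) (x : H) = (1 : ℂ) := by
    rw [inner_self_eq_norm_sq_to_K, hx]; simp
  have hxV' : ∀ v ∈ V, inner ℂ (x : H) v = 0 := fun v hv => inner_eq_zero_symm.1 (hxV v hv)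
  have hx0 : (x : H) ≠ 0 := by
    intro h; rw [h] at hx; simp at hx
  have hVsub : eigSet T V hfd h ⊆ eigSet T (V ⊔ ℂ ∙ (x : H)) hfd' h' := by
    intro μ hμ
    rw [mem_eigSet] at hμ ⊢
    obtain ⟨y, hyV, hy0, hy⟩ := hμ
    refine ⟨y, Submodule.mem_sup_left hyV, hy0, fun z hz => ?_⟩
    obtain ⟨v, hv, w, hw, rfl⟩ := Submodule.mem_sup.1 hz
    obtain ⟨c, rfl⟩ := Submodule.mem_span_singleton.1 hw
    simp only [inner_add_left, inner_smul_left, hxTV y hyV, hxV' y hyV, hy v hv]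
    ring
  apply Set.Subset.antisymm
  · intro μ hμ
    rw [mem_eigSet] at hμ
    obtain ⟨y, hyM, hy0, hy⟩ := hμ
    obtain ⟨v, hv, w, hw, hvw⟩ := Submodule.mem_sup.1 hyM
    obtain ⟨c, rfl⟩ := Submodule.mem_span_singleton.1 hw
    have hyeq : y = ⟨v, h hv⟩ + c • x := Subtype.ext hvw.symm
    by_cases hc : c = 0
    · left
      rw [mem_eigSet]
      refine ⟨y, by rw [← hvw, hc]; simpa using hv, hy0, fun z hz => hy z (Submodule.mem_sup_left hz)⟩
    · right
      have e := hy x (Submodule.mem_sup_right (Submodule.mem_span_singleton_self _))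
      rw [hyeq, LinearPMap.map_add, LinearPMap.map_smul, inner_add_right, inner_smul_right,
        hxTV ⟨v, h hv⟩ hv, ← hyeq, ← hvw, inner_add_right, inner_smul_right, hxV' v hv, hxx] at e
      rw [Set.mem_singleton_iff]
      apply mul_left_cancel₀ hc
      linear_combination -e
  · rintro μ (hμ | hμ)
    · exact hVsub hμ
    · rw [Set.mem_singleton_iff] at hμ
      by_cases hV : μ ∈ eigSet T V hfd h
      · exact hVsub hV
      have hsurj : Function.Surjective
          (compressFD T V hfd h - algebraMap ℂ (Module.End ℂ V) μ) := by
        rw [← LinearMap.injective_iff_surjective, ← LinearMap.ker_eq_bot]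
        by_contra hne
        apply hV
        change Module.End.HasUnifEigenvalue _ _ _
        rw [Module.End.HasUnifEigenvalue, ← Module.End.eigenspace, Module.End.eigenspace_def]
        exact hne
      obtain ⟨v, hv⟩ := hsurj (-(projFD V hfd (T x)))
      rw [mem_eigSet]
      refine ⟨⟨v, h v.2⟩ + x, Submodule.add_mem_sup v.2 (Submodule.mem_span_singleton_self _), ?_, ?_⟩
      · intro h0
        have : inner ℂ (x : H) ((v : H) + x) = (0 : ℂ) := by
          rw [show (v : H) + x = 0 from h0, inner_zero_right]
        rw [inner_add_right, hxV' v v.2, hxx] at this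
        simp at this
      · intro z hz
        obtain ⟨w, hw, w', hw', rfl⟩ := Submodule.mem_sup.1 hz
        obtain ⟨c, rfl⟩ := Submodule.mem_span_singleton.1 hw'
        have e1 : inner ℂ w (T ⟨v, h v.2⟩) - μ * inner ℂ w (v : H) = - inner ℂ w (T x) := by
          rw [← inner_projFD V hfd ⟨w, hw⟩, ← inner_projFD V hfd ⟨w, hw⟩ (T x), ← inner_neg_right,
            ← Submodule.coe_neg, ← hv, LinearMap.sub_apply, Submodule.coe_sub, inner_sub_right,
            Module.algebraMap_end_apply, Submodule.coe_smul, inner_smul_right]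
          rfl
        rw [LinearPMap.map_add, Submodule.coe_add]
        simp only [inner_add_left, inner_add_right, inner_smul_left,
          hxTV ⟨v, h v.2⟩ v.2, hxV' v v.2, hxV w hw, hxx, ← hμ]
        linear_combination e1

lemma exists_extend (T : H →ₗ.[ℂ] H) (Good : ℂ → ℂ → Prop) (V : Submodule ℂ H)
    (hfd : FiniteDimensional ℂ ↥V) (h : V ≤ T.domain) (t : Finset ℂ)
    (hG : ∀ l ∈ t, ∀ W : Submodule ℂ H, FiniteDimensional ℂ W →
      ∃ z ∈ numRange (T.domRestrict Wᗮ), Good l z) :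
    ∃ (M : Submodule ℂ H) (hfd' : FiniteDimensional ℂ ↥M) (h' : M ≤ T.domain) (S : Set ℂ),
      V ≤ M ∧ eigSet T M hfd' h' = eigSet T V hfd h ∪ S ∧ S.Finite ∧
      (∀ l ∈ t, ∃ z ∈ S, Good l z) ∧ (∀ z ∈ S, ∃ l ∈ t, Good l z) := by
  induction t using Finset.induction_on with
  | empty => exact ⟨V, hfd, h, ∅, le_rfl, by simp, by simp, by simp, by simp⟩
  | insert a t ha ih =>
    obtain ⟨M, hMfd, hM, S, hVM, hS, hSf, hS1, hS2⟩ :=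
      ih (fun l hl => hG l (Finset.mem_insert_of_mem hl))
    let TM : Submodule ℂ H := LinearMap.range (T.toFun.comp (Submodule.inclusion hM))
    have hW : FiniteDimensional ℂ ↥(M ⊔ TM) := inferInstance
    obtain ⟨z, ⟨x, hx, hxz⟩, hz⟩ := hG a (Finset.mem_insert_self _ _) (M ⊔ TM) hW
    have hxmem : (x : H) ∈ (M ⊔ TM)ᗮ ⊓ T.domain := x.2
    let x' : T.domain := ⟨x, hxmem.2⟩
    have hTx : T.domRestrict (M ⊔ TM)ᗮ x = T x' := LinearPMap.domRestrict_apply rfl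
    have hM' : M ⊔ ℂ ∙ (x' : H) ≤ T.domain :=
      sup_le hM ((Submodule.span_singleton_le_iff_mem _ _).2 x'.2)
    refine ⟨M ⊔ ℂ ∙ (x' : H), inferInstance, hM', S ∪ {z}, hVM.trans le_sup_left, ?_, ?_, ?_, ?_⟩
    · rw [eigSet_extend T M hMfd hM x' hx, hS, Set.union_assoc, ← hxz, hTx]
      · intro v hv
        exact hxmem.1 v (Submodule.mem_sup_left hv)
      · intro v hv
        apply inner_eq_zero_symm.1
        exact hxmem.1 (T v) (Submodule.mem_sup_right ⟨⟨v, hv⟩, rfl⟩)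
    · exact hSf.union (Set.finite_singleton z)
    · intro l hl
      rcases Finset.mem_insert.1 hl with rfl | hl
      · exact ⟨z, by simp, hz⟩
      · obtain ⟨w, hw, hw'⟩ := hS1 l hl
        exact ⟨w, Or.inl hw, hw'⟩
    · rintro w (hw | hw)
      · obtain ⟨l, hl, hl'⟩ := hS2 w hw
        exact ⟨l, Finset.mem_insert_of_mem hl, hl'⟩
      · rw [Set.mem_singleton_iff] at hw
        exact ⟨a, Finset.mem_insert_self _ _, hw ▸ hz⟩

lemma norm_sub_projFD_le (V M : Submodule ℂ H) (hV : FiniteDimensional ℂ ↥V)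
    (hM : FiniteDimensional ℂ ↥M) (hVM : V ≤ M) (x : H) :
    ‖x - (projFD M hM x : M)‖ ≤ ‖x - (projFD V hV x : V)‖ := by
  have : CompleteSpace ↥M := FiniteDimensional.complete ℂ ↥M
  have e : ((projFD M hM x : M) : H) = M.starProjection x := by simp [projFD]
  rw [e, Submodule.starProjection_minimal]
  exact ciInf_le ⟨0, by rintro _ ⟨_, rfl⟩; positivity⟩
    (⟨(projFD V hV x : V), hVM (projFD V hV x).2⟩ : M)

lemma tendsto_projFD (V M : ℕ → Submodule ℂ H) (hV : ∀ n, FiniteDimensional ℂ ↥(V n))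
    (hM : ∀ n, FiniteDimensional ℂ ↥(M n)) (hVM : ∀ n, V n ≤ M n)
    (hP : ∀ x : H, Tendsto (fun n => ((projFD (V n) (hV n) x : ↥(V n)) : H)) atTop (nhds x))
    (x : H) : Tendsto (fun n => ((projFD (M n) (hM n) x : ↥(M n)) : H)) atTop (nhds x) := by
  have h := tendsto_iff_norm_sub_tendsto_zero.1 (hP x)
  rw [tendsto_iff_norm_sub_tendsto_zero]
  refine squeeze_zero (fun _ => norm_nonneg _) (fun n => ?_) h
  rw [norm_sub_rev, norm_sub_rev _ x]
  exact norm_sub_projFD_le _ _ _ _ (hVM n) x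

/-- Theorem 6.4: any nonempty compact subset `Ω ⊆ W_{e1}(T)` can be filled with spurious
eigenvalues of a projection method extending given subspaces `V_n`; if `Ω` is a finite
subset of the interior of `W_{e1}(T)`, the spectra can be arranged to be exactly
`σ(T_{V_n}) ∪ Ω`. -/
theorem compact_subset_We1_filled_with_spurious_eigenvalues
    [TopologicalSpace.SeparableSpace H] (hinf : ¬FiniteDimensional ℂ H)
    (T : H →ₗ.[ℂ] H) (hdense : Dense (T.domain : Set H))
    (Vn : ℕ → Submodule ℂ H)
    (hVfd : ∀ n, FiniteDimensional ℂ ↥(Vn n)) (hVle : ∀ n, Vn n ≤ T.domain)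
    (hPV : ∀ x : H, Tendsto (fun n => ((projFD (Vn n) (hVfd n) x : ↥(Vn n)) : H))
      atTop (nhds x))
    (Ω : Set ℂ) (hΩne : Ω.Nonempty) (hΩcpt : IsCompact Ω) (hΩWe1 : Ω ⊆ We1 T) :
    (∃ (Hn : ℕ → Submodule ℂ H) (hfd : ∀ n, FiniteDimensional ℂ ↥(Hn n))
        (hle : ∀ n, Hn n ≤ T.domain),
      (∀ n, Vn n ≤ Hn n) ∧
      (∀ x : H, Tendsto (fun n => ((projFD (Hn n) (hfd n) x : ↥(Hn n)) : H))
        atTop (nhds x)) ∧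
      Tendsto (fun n => ⨆ lam : Ω, Metric.infDist (lam : ℂ)
        (eigSet T (Hn n) (hfd n) (hle n))) atTop (nhds 0)) ∧
    (Ω.Finite → Ω ⊆ interior (We1 T) →
      ∃ (Hn : ℕ → Submodule ℂ H) (hfd : ∀ n, FiniteDimensional ℂ ↥(Hn n))
          (hle : ∀ n, Hn n ≤ T.domain),
        (∀ n, Vn n ≤ Hn n) ∧
        (∀ x : H, Tendsto (fun n => ((projFD (Hn n) (hfd n) x : ↥(Hn n)) : H))
          atTop (nhds x)) ∧
        Tendsto (fun n => ⨆ lam : Ω, Metric.infDist (lam : ℂ)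
          (eigSet T (Hn n) (hfd n) (hle n))) atTop (nhds 0) ∧
        ∀ n, eigSet T (Hn n) (hfd n) (hle n) =
          eigSet T (Vn n) (hVfd n) (hVle n) ∪ Ω) := by
  constructor
  · have key : ∀ n : ℕ, ∃ (M : Submodule ℂ H) (hfd : FiniteDimensional ℂ ↥M) (hle : M ≤ T.domain),
        Vn n ≤ M ∧ ∀ lam : Ω, Metric.infDist (lam : ℂ) (eigSet T M hfd hle) ≤ 1 / ((n : ℝ) + 1) := by
      intro n
      have hε : (0 : ℝ) < 1 / ((n : ℝ) + 1) / 2 := by positivity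
      obtain ⟨t, htΩ, htf, hcov⟩ := totallyBounded_iff_subset.1 hΩcpt.totallyBounded _
        (Metric.dist_mem_uniformity hε)
      obtain ⟨M, hfd, hle, S, hVM, hS, hSf, hS1, hS2⟩ := exists_extend T
        (fun l z => dist l z < 1 / ((n : ℝ) + 1) / 2) (Vn n) (hVfd n) (hVle n) htf.toFinset (by
          intro l hl W hW
          have hl' := hΩWe1 (htΩ (htf.mem_toFinset.1 hl))
          have := Set.mem_iInter₂.1 hl' W hW
          exact Metric.mem_closure_iff.1 this _ hε)
      refine ⟨M, hfd, hle, hVM, fun lam => ?_⟩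
      obtain ⟨l, hl, hl'⟩ := Set.mem_iUnion₂.1 (hcov lam.2)
      obtain ⟨z, hz, hz'⟩ := hS1 l (htf.mem_toFinset.2 hl)
      have hd : dist (lam : ℂ) l < 1 / ((n : ℝ) + 1) / 2 := hl'
      calc Metric.infDist (lam : ℂ) (eigSet T M hfd hle) ≤ dist (lam : ℂ) z :=
            Metric.infDist_le_dist_of_mem (by rw [hS]; exact Or.inr hz)
        _ ≤ dist (lam : ℂ) l + dist l z := dist_triangle _ _ _
        _ ≤ 1 / ((n : ℝ) + 1) := by linarith
    choose M hfd hle hVM hd using key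
    refine ⟨M, hfd, hle, hVM, tendsto_projFD Vn M hVfd hfd hVM hPV, ?_⟩
    have : Nonempty Ω := hΩne.to_subtype
    refine squeeze_zero (fun n => Real.iSup_nonneg fun _ => Metric.infDist_nonneg)
      (fun n => ciSup_le (hd n)) tendsto_one_div_add_atTop_nhds_zero_nat
  · intro hfin hint
    have key : ∀ n : ℕ, ∃ (M : Submodule ℂ H) (hfd : FiniteDimensional ℂ ↥M) (hle : M ≤ T.domain),
        Vn n ≤ M ∧ eigSet T M hfd hle = eigSet T (Vn n) (hVfd n) (hVle n) ∪ Ω := by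
      intro n
      obtain ⟨M, hfd, hle, S, hVM, hS, hSf, hS1, hS2⟩ := exists_extend T
        (fun l z => l = z) (Vn n) (hVfd n) (hVle n) hfin.toFinset (by
          intro l hl W hW
          have hl' := hint (hfin.mem_toFinset.1 hl)
          have hsub : We1 T ⊆ closure (numRange (T.domRestrict Wᗮ)) :=
            Set.iInter₂_subset W hW
          exact ⟨l, convex_interior_closure (numRange_convex _) (interior_mono hsub hl'), rfl⟩)
      refine ⟨M, hfd, hle, hVM, ?_⟩
      rw [hS]
      congr 1
      ext z
      constructor
      · intro hz
        obtain ⟨l, hl, rfl⟩ := hS2 z hz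
        exact hfin.mem_toFinset.1 hl
      · intro hz
        obtain ⟨l, hl, rfl⟩ := hS1 z (hfin.mem_toFinset.2 hz)
        exact hl
    choose M hfd hle hVM hd using key
    refine ⟨M, hfd, hle, hVM, tendsto_projFD Vn M hVfd hfd hVM hPV, ?_, hd⟩
    have h0 : ∀ n, (⨆ lam : Ω, Metric.infDist (lam : ℂ) (eigSet T (M n) (hfd n) (hle n))) = 0 := by
      intro n
      have : ∀ lam : Ω, Metric.infDist (lam : ℂ) (eigSet T (M n) (hfd n) (hle n)) = 0 :=
        fun lam => Metric.infDist_zero_of_mem (by rw [hd]; exact Or.inr lam.2)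
      simp [this]
    simp [h0]
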